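/- Let n ≥ 1 and let b₀, b₁, …, bₙ be real numbers with b₁, …, bₙ not all zero. Let P be the family of monic real polynomials p(λ) = λⁿ + a₁λⁿ⁻¹ + ⋯ + aₙ₋₁λ + aₙ (with real coefficients aⱼ) satisfying the affine constraint b₀ + Σⱼ₌₁ⁿ bⱼaⱼ = 0. Define h(λ) = Σⱼ₌₀ⁿ bⱼ·C(n,j)·λʲ where C(n,j) is the binomial coefficient, and k = max{j : bⱼ ≠ 0}. Then the infimum a* := inf{a(p) : p ∈ P} of the abscissa over P equals −max{ζ ∈ ℝ : h⁽ⁱ⁾(ζ) = 0 for some i ∈ {0, …, k−1}}, where h⁽ⁱ⁾ denotes the i-th derivative of h. Moreover, the infimum a* is attained by some p* ∈ P if and only if −a* is a root of h itself, in which case p*(λ) = (λ − γ)ⁿ with γ = a* is a minimizer belonging to P. -/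

import Mathlib

open Polynomial

/-- The abscissa of a real polynomial: the supremum of the real parts of its
complex roots. -/
noncomputable def abscissa (p : Polynomial ℝ) : ℝ :=
  sSup {x : ℝ | ∃ z : ℂ, Polynomial.aeval z p = 0 ∧ z.re = x}

/-- The family of monic real polynomials `λⁿ + a₁λⁿ⁻¹ + ⋯ + aₙ` whose coefficients
satisfy the affine constraint `b₀ + Σⱼ₌₁ⁿ bⱼaⱼ = 0`. -/
def constrainedFamily (n : ℕ) (b : ℕ → ℝ) : Set (Polynomial ℝ) :=
  {p | p.Monic ∧ p.natDegree = n ∧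
    b 0 + ∑ j ∈ Finset.Icc 1 n, b j * p.coeff (n - j) = 0}

/-- The auxiliary polynomial `h(λ) = Σⱼ₌₀ⁿ bⱼ·C(n,j)·λʲ`. -/
noncomputable def hPoly (n : ℕ) (b : ℕ → ℝ) : Polynomial ℝ :=
  ∑ j ∈ Finset.range (n + 1), Polynomial.C (b j * (n.choose j : ℝ)) * Polynomial.X ^ j

/-- The linear functional behind the constraint. -/
noncomputable def LF (n : ℕ) (b : ℕ → ℝ) : Polynomial ℝ →ₗ[ℝ] ℝ :=
  ∑ j ∈ Finset.range (n + 1), b j • Polynomial.lcoeff ℝ (n - j)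

lemma LF_apply (n : ℕ) (b : ℕ → ℝ) (p : Polynomial ℝ) :
    LF n b p = ∑ j ∈ Finset.range (n + 1), b j * p.coeff (n - j) := by
  simp [LF, LinearMap.sum_apply]

lemma mem_family (n : ℕ) (b : ℕ → ℝ) (p : Polynomial ℝ) :
    p ∈ constrainedFamily n b ↔ p.Monic ∧ p.natDegree = n ∧ LF n b p = 0 := by
  unfold constrainedFamily
  simp only [Set.mem_setOf_eq]
  refine and_congr_right fun hm => and_congr_right fun hd => ?_
  have h1 : p.coeff n = 1 := by rw [← hd]; exact hm
  have h2 : Finset.Icc 1 n = Finset.Ico (0 + 1) (n + 1) := by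
    ext x; simp only [Finset.mem_Icc, Finset.mem_Ico]; omega
  rw [LF_apply, Finset.range_eq_Ico, Finset.sum_eq_sum_Ico_succ_bot (by omega), h2]
  simp [h1]

lemma deriv_eval (n : ℕ) (b : ℕ → ℝ) (x : ℝ) (i : ℕ) (hi : i ≤ n) :
    ((fun q => Polynomial.derivative q)^[i] (hPoly n b)).eval x =
      (n.descFactorial i : ℝ) * LF n b ((X + C x) ^ (n - i)) := by
  change (Polynomial.derivative^[i] (hPoly n b)).eval x = _
  rw [LF_apply, Finset.mul_sum, hPoly, Polynomial.iterate_derivative_sum,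
    Polynomial.eval_finset_sum]
  refine Finset.sum_congr rfl fun m hm => ?_
  have hmn : m ≤ n := by have := Finset.mem_range.1 hm; omega
  rw [Polynomial.iterate_derivative_C_mul, Polynomial.iterate_derivative_X_pow_eq_smul,
    Polynomial.coeff_X_add_C_pow]
  simp only [eval_mul, eval_C, eval_smul, eval_pow, eval_X]
  by_cases hmi : i ≤ m
  · have e1 : n - i - (n - m) = m - i := by omega
    rw [e1]
    have e2 : n.choose m * m.descFactorial i = n.descFactorial i * (n - i).choose (n - m) := by
      have h3 := Nat.choose_mul (n := n) hmi
      have h4 : (n - i).choose (n - m) = (n - i).choose (m - i) := by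
        rw [← Nat.choose_symm (show m - i ≤ n - i by omega)]
        congr 1; omega
      rw [h4, Nat.descFactorial_eq_factorial_mul_choose, Nat.descFactorial_eq_factorial_mul_choose]
      calc _ = i.factorial * (n.choose m * m.choose i) := by ring
        _ = _ := by rw [h3]; ring
    have e3 : (n.choose m : ℝ) * (m.descFactorial i : ℝ)
        = (n.descFactorial i : ℝ) * ((n - i).choose (n - m) : ℝ) := by exact_mod_cast e2
    simp only [nsmul_eq_mul, smul_eq_mul]
    linear_combination (b m * x ^ (m - i)) * e3
  · have e1 : m.descFactorial i = 0 := Nat.descFactorial_of_lt (by omega)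
    have e2 : (n - i).choose (n - m) = 0 := Nat.choose_eq_zero_of_lt (by omega)
    simp [e1, e2]

lemma nonneg_mul {p q : Polynomial ℝ} (hp : ∀ i, 0 ≤ p.coeff i) (hq : ∀ i, 0 ≤ q.coeff i) (i : ℕ) :
    0 ≤ (p * q).coeff i := by
  rw [Polynomial.coeff_mul]
  exact Finset.sum_nonneg fun x _ => mul_nonneg (hp _) (hq _)

lemma stable_nonneg (d : ℕ) : ∀ p : Polynomial ℝ, p.natDegree = d → p.Monic →
    (∀ z : ℂ, aeval z p = 0 → z.re ≤ 0) → ∀ i, 0 ≤ p.coeff i := by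
  induction d using Nat.strong_induction_on with
  | _ d ih =>
  intro p hd hm hz
  by_cases h0 : d = 0
  · have : p = 1 := hm.natDegree_eq_zero.1 (by omega)
    intro i
    rw [this, Polynomial.coeff_one]
    split_ifs <;> norm_num
  obtain ⟨z, hzr⟩ : ∃ z : ℂ, aeval z p = 0 := by
    refine IsAlgClosed.exists_aeval_eq_zero ℂ p ?_
    intro h
    have := Polynomial.natDegree_eq_of_degree_eq_some (n := 0) h
    omega
  have hre := hz z hzr
  have key : ∀ f : Polynomial ℝ, f.Monic → 0 < f.natDegree → f ∣ p → (∀ i, 0 ≤ f.coeff i) →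
      ∀ i, 0 ≤ p.coeff i := by
    rintro f hf hfd ⟨g, rfl⟩ hfn
    have hg : g.Monic := hf.of_mul_monic_left hm
    have hdg : f.natDegree + g.natDegree = d := by rw [← hd, hf.natDegree_mul hg]
    refine nonneg_mul hfn (ih g.natDegree (by omega) g rfl hg fun w hw => hz w ?_)
    simp [hw]
  by_cases him : z.im = 0
  · have hzz : z = ((z.re : ℝ) : ℂ) := by apply Complex.ext <;> simp [him]
    refine key (X - C z.re) (monic_X_sub_C _) (by simp) ?_ ?_
    · rw [Polynomial.dvd_iff_isRoot, Polynomial.IsRoot]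
      rw [hzz] at hzr
      have : ((p.eval z.re : ℝ) : ℂ) = 0 := by
        rw [← hzr]
        exact (Polynomial.aeval_algebraMap_apply_eq_algebraMap_eval z.re p).symm
      exact_mod_cast this
    · intro i
      rw [coeff_sub, coeff_X, coeff_C]
      split_ifs <;> first | omega | linarith
  · have hdeg : (X ^ 2 - C (2 * z.re) * X + C (‖z‖ ^ 2) : Polynomial ℝ).natDegree = 2 := by
      compute_degree!
    refine key (X ^ 2 - C (2 * z.re) * X + C (‖z‖ ^ 2)) ?_ (by omega) 
      (Polynomial.quadratic_dvd_of_aeval_eq_zero_im_ne_zero p hzr him) ?_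
    · monicity!
    · intro i
      have := sq_nonneg ‖z‖
      rw [coeff_add, coeff_sub, coeff_X_pow, coeff_C_mul, coeff_X, coeff_C]
      split_ifs <;> first | omega | linarith

lemma abs_bdd (p : Polynomial ℝ) (hp : p ≠ 0) :
    BddAbove {x : ℝ | ∃ z : ℂ, Polynomial.aeval z p = 0 ∧ z.re = x} := by
  have : {x : ℝ | ∃ z : ℂ, Polynomial.aeval z p = 0 ∧ z.re = x} ⊆ Complex.re '' (p.rootSet ℂ) := by
    rintro x ⟨z, hz, rfl⟩
    exact ⟨z, (Polynomial.mem_rootSet).2 ⟨hp, hz⟩, rfl⟩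
  exact (((p.rootSet_finite ℂ).image _).subset this).bddAbove

lemma re_le_abscissa (p : Polynomial ℝ) (hp : p ≠ 0) (z : ℂ) (hz : aeval z p = 0) :
    z.re ≤ abscissa p := le_csSup (abs_bdd p hp) ⟨z, hz, rfl⟩

lemma abscissa_le (p : Polynomial ℝ) (hp : 1 ≤ p.natDegree) (a : ℝ)
    (h : ∀ z : ℂ, aeval z p = 0 → z.re ≤ a) : abscissa p ≤ a := by
  refine csSup_le ?_ ?_
  · obtain ⟨z, hz⟩ : ∃ z : ℂ, aeval z p = 0 := by
      refine IsAlgClosed.exists_aeval_eq_zero ℂ p ?_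
      intro h
      have := Polynomial.natDegree_eq_of_degree_eq_some (n := 0) h
      omega
    exact ⟨_, z, hz, rfl⟩
  · rintro x ⟨z, hz, rfl⟩
    exact h z hz

lemma abscissa_pow (n : ℕ) (hn : 1 ≤ n) (γ : ℝ) : abscissa ((X - C γ) ^ n) = γ := by
  apply le_antisymm
  · refine abscissa_le _ (by simpa using hn) _ fun z hz => ?_
    have hz' : z - (γ : ℂ) = 0 := by
      have : (z - (γ : ℂ)) ^ n = 0 := by simpa using hz
      exact pow_eq_zero_iff (by omega) |>.1 this
    rw [sub_eq_zero.1 hz']; simp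
  · have := re_le_abscissa ((X - C γ) ^ n) (pow_ne_zero _ (X_sub_C_ne_zero γ)) (γ : ℂ)
      (by simp; omega)
    simpa using this

/-- Expansion of the constraint at a shifted point. -/
lemma LF_taylor (n : ℕ) (b : ℕ → ℝ) (p : Polynomial ℝ) (hd : p.natDegree = n) (x : ℝ) :
    LF n b p = ∑ i ∈ Finset.range (n + 1),
      (taylor (-x) p).coeff i * LF n b ((X + C x) ^ i) := by
  conv_lhs => rw [← Polynomial.sum_taylor_eq p (-x)]
  rw [Polynomial.sum_over_range' _ (by simp) (n + 1) (by rw [natDegree_taylor]; omega), map_sum]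
  refine Finset.sum_congr rfl fun i _ => ?_
  rw [← smul_eq_C_mul, map_smul]
  simp

lemma taylor_nonneg (p : Polynomial ℝ) (hm : p.Monic) (x : ℝ) (h : abscissa p ≤ x) (i : ℕ) :
    0 ≤ (taylor x p).coeff i := by
  refine stable_nonneg _ (taylor x p) rfl ?_ ?_ i
  · rw [Monic, leadingCoeff_taylor]; exact hm
  · intro z hz
    have : aeval (z + (x : ℂ)) p = 0 := by
      rw [taylor_apply, aeval_comp] at hz
      simpa using hz
    have := re_le_abscissa p hm.ne_zero _ this
    simp at this
    linarith

lemma lower (n : ℕ) (b : ℕ → ℝ) (σ x : ℝ) (hg : ∀ i ≤ n, 0 ≤ σ * LF n b ((X + C x) ^ i))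
    (p : Polynomial ℝ) (hp : p ∈ constrainedFamily n b) (hx : abscissa p ≤ -x) :
    σ * LF n b ((X + C x) ^ n) = 0 := by
  obtain ⟨hm, hd, hL⟩ := (mem_family n b p).1 hp
  have h1 := LF_taylor n b p hd x
  have hc : (taylor (-x) p).coeff n = 1 := by
    have : (taylor (-x) p).Monic := by rw [Monic, leadingCoeff_taylor]; exact hm
    have h2 := this.coeff_natDegree
    rwa [natDegree_taylor, hd] at h2
  have h3 : 0 = ∑ i ∈ Finset.range (n + 1),
      (taylor (-x) p).coeff i * (σ * LF n b ((X + C x) ^ i)) := by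
    rw [← mul_zero σ, ← hL, h1, Finset.mul_sum]
    refine Finset.sum_congr rfl fun i _ => by ring
  have h4 := (Finset.sum_eq_zero_iff_of_nonneg (fun i hi => mul_nonneg
    (taylor_nonneg p hm _ hx i) (hg i (by have := Finset.mem_range.1 hi; omega)))).1 h3.symm n
    (by simp)
  rwa [hc, one_mul] at h4

lemma root_above (Q : Polynomial ℝ) (hd : 0 < Q.natDegree) (hl : 0 < Q.leadingCoeff) (y : ℝ)
    (hy : Q.eval y < 0) : ∃ z, y < z ∧ Q.eval z = 0 := by
  have ht := Q.tendsto_atTop_of_leadingCoeff_nonneg (natDegree_pos_iff_degree_pos.1 hd) hl.le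
  obtain ⟨w, hw1, hw2⟩ := ((ht.eventually_gt_atTop 0).and (Filter.eventually_gt_atTop y)).exists
  obtain ⟨z, hz, hz0⟩ := intermediate_value_Icc hw2.le (Q.continuous.continuousOn)
    (show (0 : ℝ) ∈ Set.Icc (Q.eval y) (Q.eval w) from ⟨hy.le, hw1.le⟩)
  refine ⟨z, lt_of_le_of_ne hz.1 ?_, hz0⟩
  rintro rfl
  exact hy.ne hz0

/-- one-parameter family with prescribed sign -/
lemma big (n m : ℕ) (hm : m ≤ n) (b : ℕ → ℝ) (σ x : ℝ)
    (h : 0 < σ * LF n b ((X + C x) ^ (n - m))) :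
    ∃ M : ℝ, 0 ≤ M ∧ 0 < σ * LF n b ((X + C x) ^ (n - m) * (X + C (x + M)) ^ m) := by
  set R : Polynomial ℝ := ∑ l ∈ Finset.range (m + 1),
    C (σ * (m.choose l : ℝ) * LF n b ((X + C x) ^ (n - l))) * X ^ l with hR
  have hE : ∀ M : ℝ, σ * LF n b ((X + C x) ^ (n - m) * (X + C (x + M)) ^ m) = R.eval M := by
    intro M
    have e : ((X + C x) ^ (n - m) * (X + C (x + M)) ^ m : Polynomial ℝ) =
        ∑ l ∈ Finset.range (m + 1), ((m.choose l : ℝ) * M ^ l) • (X + C x) ^ (n - l) := by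
      have : (X + C (x + M) : Polynomial ℝ) = C M + (X + C x) := by rw [C_add]; ring
      rw [this, add_pow (C M), Finset.mul_sum]
      refine Finset.sum_congr rfl fun l hl => ?_
      have hl' : l ≤ m := by have := Finset.mem_range.1 hl; omega
      have e1 : n - l = (n - m) + (m - l) := by omega
      rw [e1, pow_add, smul_eq_C_mul]
      simp only [C_mul, C_pow, map_natCast]
      ring
    rw [e, map_sum, hR, eval_finset_sum, Finset.mul_sum]
    refine Finset.sum_congr rfl fun l _ => ?_
    simp only [map_smul, smul_eq_mul, eval_mul, eval_C, eval_pow, eval_X]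
    ring
  have hc : R.coeff m = σ * LF n b ((X + C x) ^ (n - m)) := by
    rw [hR, finset_sum_coeff, Finset.sum_eq_single m]
    · rw [coeff_C_mul, coeff_X_pow, if_pos rfl]; simp
    · intro l _ hl
      rw [coeff_C_mul, coeff_X_pow, if_neg (Ne.symm hl), mul_zero]
    · simp
  have hdle : R.natDegree ≤ m := by
    rw [hR]
    refine natDegree_sum_le_of_forall_le _ _ fun l hl => ?_
    refine (natDegree_C_mul_X_pow_le _ _).trans ?_
    have := Finset.mem_range.1 hl; omega
  have hd : R.natDegree = m := natDegree_eq_of_le_of_coeff_ne_zero hdle (by rw [hc]; exact h.ne')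
  have hl : 0 < R.leadingCoeff := by rw [leadingCoeff, hd, hc]; exact h
  by_cases hm0 : m = 0
  · subst hm0
    refine ⟨0, le_rfl, ?_⟩
    simpa using h
  · have ht := R.tendsto_atTop_of_leadingCoeff_nonneg
      (natDegree_pos_iff_degree_pos.1 (by omega)) hl.le
    obtain ⟨w, hw1, hw2⟩ :=
      ((ht.eventually_gt_atTop 0).and (Filter.eventually_ge_atTop 0)).exists
    exact ⟨w, hw2, by rw [hE]; exact hw1⟩

lemma cont_coeff (c : ℕ → ℝ → ℝ) (hc : ∀ j, Continuous (c j)) (n : ℕ) : ∀ m,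
    Continuous fun t => (∏ j ∈ Finset.range n, (X + C (c j t)) : Polynomial ℝ).coeff m := by
  induction n with
  | zero => intro m; simpa using continuous_const
  | succ n ih =>
    intro m
    simp only [Finset.prod_range_succ, coeff_mul]
    refine continuous_finsetSum _ fun y _ => (ih _).mul ?_
    simp only [coeff_add, coeff_C]
    split_ifs
    · exact continuous_const.add (hc _)
    · exact continuous_const.add continuous_const

lemma prod_ite (n m : ℕ) (hm : m ≤ n) (x M : ℝ) :
    (∏ j ∈ Finset.range n, (X + C (x + if j < m then M else 0)) : Polynomial ℝ) =
      (X + C x) ^ (n - m) * (X + C (x + M)) ^ m := by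
  obtain ⟨d, rfl⟩ := Nat.exists_eq_add_of_le hm
  rw [Finset.prod_range_add, mul_comm]
  congr 1
  · rw [Finset.prod_congr rfl (g := fun _ => X + C x)]
    · simp
    · intro j _; simp
  · rw [Finset.prod_congr rfl (g := fun _ => X + C (x + M))]
    · simp
    · intro j hj; simp [Finset.mem_range.1 hj]

lemma prod_abscissa (n : ℕ) (hn : 1 ≤ n) (x : ℝ) (s : ℕ → ℝ) (hs : ∀ j, 0 ≤ s j) :
    (∏ j ∈ Finset.range n, (X + C (x + s j)) : Polynomial ℝ).Monic ∧
    (∏ j ∈ Finset.range n, (X + C (x + s j)) : Polynomial ℝ).natDegree = n ∧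
    abscissa (∏ j ∈ Finset.range n, (X + C (x + s j)) : Polynomial ℝ) ≤ -x := by
  have hd : (∏ j ∈ Finset.range n, (X + C (x + s j)) : Polynomial ℝ).natDegree = n := by
    rw [natDegree_prod_of_monic _ _ fun j _ => monic_X_add_C _]
    simp only [natDegree_X_add_C]
    simp
  refine ⟨monic_prod_of_monic _ _ fun j _ => monic_X_add_C _, hd, ?_⟩
  refine abscissa_le _ (by omega) _ fun z hz => ?_
  rw [map_prod, Finset.prod_eq_zero_iff] at hz
  obtain ⟨j, _, hj⟩ := hz
  have h2 : z + ((x + s j : ℝ) : ℂ) = 0 := by simpa using hj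
  have h3 := congrArg Complex.re h2
  simp at h3
  linarith [hs j]

lemma upper (n i k : ℕ) (hn : 1 ≤ n) (hi : i ≤ n) (hk : k ≤ n) (b : ℕ → ℝ) (σ x : ℝ)
    (h1 : σ * LF n b ((X + C x) ^ (n - i)) < 0) (h2 : 0 < σ * LF n b ((X + C x) ^ (n - k))) :
    ∃ p ∈ constrainedFamily n b, abscissa p ≤ -x := by
  obtain ⟨M, hM, hM'⟩ := big n i hi b (-σ) x (by linarith)
  obtain ⟨N, hN, hN'⟩ := big n k hk b σ x h2
  let s : ℕ → ℝ → ℝ := fun j t =>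
    (1 - t) * (if j < i then M else 0) + t * (if j < k then N else 0)
  have hsc : ∀ j, Continuous (s j) := fun j => by fun_prop
  let P : ℝ → Polynomial ℝ := fun t => ∏ j ∈ Finset.range n, (X + C (x + s j t))
  have hF : Continuous fun t => σ * LF n b (P t) := by
    simp only [LF_apply]
    refine continuous_const.mul (continuous_finsetSum _ fun j _ => continuous_const.mul ?_)
    exact cont_coeff (fun j t => x + s j t) (fun j => continuous_const.add (hsc j)) n _
  have hP0 : P 0 = (X + C x) ^ (n - i) * (X + C (x + M)) ^ i := by
    rw [← prod_ite n i hi]; simp [P, s]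
  have hP1 : P 1 = (X + C x) ^ (n - k) * (X + C (x + N)) ^ k := by
    rw [← prod_ite n k hk]; simp [P, s]
  obtain ⟨t, ht, ht0⟩ := intermediate_value_Icc (zero_le_one' ℝ) hF.continuousOn
    (show (0 : ℝ) ∈ Set.Icc _ _ from ⟨by simp only [hP0]; linarith, by simp only [hP1]; linarith⟩)
  have hσ : σ ≠ 0 := by rintro rfl; simp at h2
  obtain ⟨a1, a2, a3⟩ := prod_abscissa n hn x (fun j => s j t) (fun j => by
    have := ht.1
    have : 0 ≤ 1 - t := by linarith [ht.2]
    simp only [s]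
    split_ifs <;> positivity)
  refine ⟨P t, (mem_family n b _).2 ⟨a1, a2, ?_⟩, a3⟩
  exact (mul_eq_zero.1 ht0).resolve_left hσ

/-- Burke–Guillaume–Mordukhovich–Overton abscissa minimization (real case):
the infimal abscissa over the constrained family equals
`−max{ζ : h⁽ⁱ⁾(ζ) = 0 for some i ∈ {0,…,k−1}}`, where `k = max{j : bⱼ ≠ 0}`;
the infimum is attained iff `−a*` is a root of `h` itself, in which case
`p*(λ) = (λ − a*)ⁿ` is a minimizer belonging to the family. -/
theorem abscissa_minimization_real (n : ℕ) (hn : 1 ≤ n) (b : ℕ → ℝ)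
    (hb : ∃ j, 1 ≤ j ∧ j ≤ n ∧ b j ≠ 0)
    (k : ℕ) (hkn : k ≤ n) (hk : b k ≠ 0) (hkmax : ∀ j ≤ n, b j ≠ 0 → j ≤ k) :
    (∃ ζ : ℝ,
      IsGreatest {ζ : ℝ | ∃ i < k,
          ((fun q => Polynomial.derivative q)^[i] (hPoly n b)).eval ζ = 0} ζ ∧
      sInf (abscissa '' constrainedFamily n b) = -ζ) ∧
    ((∃ p ∈ constrainedFamily n b,
        abscissa p = sInf (abscissa '' constrainedFamily n b)) ↔
      (hPoly n b).eval (-(sInf (abscissa '' constrainedFamily n b))) = 0) ∧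
    ((hPoly n b).eval (-(sInf (abscissa '' constrainedFamily n b))) = 0 →
      (Polynomial.X - Polynomial.C (sInf (abscissa '' constrainedFamily n b))) ^ n
          ∈ constrainedFamily n b ∧
      abscissa ((Polynomial.X
          - Polynomial.C (sInf (abscissa '' constrainedFamily n b))) ^ n)
        = sInf (abscissa '' constrainedFamily n b)) := by
  have hk1 : 1 ≤ k := by
    obtain ⟨j, h1, h2, h3⟩ := hb
    exact h1.trans (hkmax j h2 h3)
  have hcoef : ∀ m, (hPoly n b).coeff m = if m ≤ n then b m * (n.choose m : ℝ) else 0 := by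
    intro m
    rw [hPoly, finset_sum_coeff]
    simp only [coeff_C_mul, coeff_X_pow]
    simp [Nat.lt_succ_iff]
  -- the scaled derivatives
  let Q : ℕ → Polynomial ℝ := fun i => C (b k) * derivative^[i] (hPoly n b)
  have hQe : ∀ i x, (Q i).eval x = b k * (derivative^[i] (hPoly n b)).eval x := by
    intro i x; simp [Q]
  have hQc : ∀ i m, (Q i).coeff m =
      b k * (((m + i).descFactorial i : ℝ) * (hPoly n b).coeff (m + i)) := by
    intro i m
    simp only [Q, coeff_C_mul, coeff_iterate_derivative, nsmul_eq_mul]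
  have hQtop : ∀ i ≤ k, 0 < (Q i).coeff (k - i) := by
    intro i hi
    rw [hQc, Nat.sub_add_cancel hi, hcoef, if_pos hkn]
    have h1 : 0 < b k * b k := mul_self_pos.2 hk
    have h2 : (0 : ℝ) < (k.descFactorial i : ℝ) := by
      exact_mod_cast Nat.descFactorial_pos.2 hi
    have h3 : (0 : ℝ) < (n.choose k : ℝ) := by exact_mod_cast Nat.choose_pos hkn
    have := mul_pos (mul_pos h1 h2) h3
    linarith
  have hQz : ∀ i m, k < m + i → (Q i).coeff m = 0 := by
    intro i m hm
    rw [hQc, hcoef]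
    split_ifs with h
    · have : b (m + i) = 0 := by
        by_contra hne
        have := hkmax _ h hne
        omega
      simp [this]
    · simp
  have hQd : ∀ i ≤ k, (Q i).natDegree = k - i := by
    intro i hi
    refine natDegree_eq_of_le_of_coeff_ne_zero ?_ (hQtop i hi).ne'
    rw [natDegree_le_iff_coeff_eq_zero]
    intro m hm
    exact hQz i m (by omega)
  have hQl : ∀ i ≤ k, 0 < (Q i).leadingCoeff := by
    intro i hi
    rw [leadingCoeff, hQd i hi]; exact hQtop i hi
  have hQk : ∀ x, 0 < (Q k).eval x := by
    intro x
    have h := hQd k le_rfl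
    rw [Nat.sub_self] at h
    have h2 := hQtop k le_rfl
    rw [Nat.sub_self] at h2
    rw [eq_C_of_natDegree_eq_zero h, eval_C]; exact h2
  have hQbig : ∀ i, k < i → Q i = 0 := by
    intro i hi
    ext m
    rw [hQz i m (by omega), coeff_zero]
  have hQLF : ∀ i ≤ n, ∀ x, (Q i).eval x =
      (n.descFactorial i : ℝ) * (b k * LF n b ((X + C x) ^ (n - i))) := by
    intro i hi x
    rw [hQe]
    have := deriv_eval n b x i hi
    change (derivative^[i] (hPoly n b)).eval x = _ at this
    rw [this]; ring
  have hdpos : ∀ i ≤ n, (0 : ℝ) < (n.descFactorial i : ℝ) := by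
    intro i hi
    exact_mod_cast Nat.descFactorial_pos.2 hi
  -- the greatest root
  have hset : {ζ : ℝ | ∃ i < k,
      ((fun q => Polynomial.derivative q)^[i] (hPoly n b)).eval ζ = 0} =
      {ζ : ℝ | ∃ i < k, (Q i).eval ζ = 0} := by
    ext ζ
    simp only [Set.mem_setOf_eq, hQe, mul_eq_zero, hk, false_or]
  have hgr : ∃ ζ, IsGreatest {ζ : ℝ | ∃ i < k, (Q i).eval ζ = 0} ζ := by
    have hfin : {ζ : ℝ | ∃ i < k, (Q i).eval ζ = 0}.Finite := by
      have : {ζ : ℝ | ∃ i < k, (Q i).eval ζ = 0} = ⋃ i ∈ Set.Iio k, {ζ : ℝ | (Q i).IsRoot ζ} := by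
        ext ζ; simp [IsRoot]
      rw [this]
      refine (Set.finite_Iio k).biUnion fun i hi => Polynomial.finite_setOf_isRoot ?_
      intro h0
      have := hQl i (le_of_lt hi)
      simp [h0] at this
    have hne : {ζ : ℝ | ∃ i < k, (Q i).eval ζ = 0}.Nonempty := by
      have h1 : (Q (k - 1)).natDegree = 1 := by rw [hQd _ (by omega)]; omega
      obtain ⟨r, hr⟩ := Polynomial.exists_root_of_degree_eq_one
        ((degree_eq_iff_natDegree_eq_of_pos one_pos).2 h1)
      exact ⟨r, k - 1, by omega, hr⟩
    obtain ⟨ζ, h1, h2⟩ := hfin.exists_maximalFor id _ hne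
    refine ⟨ζ, h1, fun y hy => ?_⟩
    by_contra hlt
    exact hlt (h2 hy (le_of_not_ge hlt))
  obtain ⟨ζ, hζ⟩ := hgr
  have hQnn : ∀ i, ∀ x, ζ ≤ x → 0 ≤ (Q i).eval x := by
    intro i x hx
    rcases lt_trichotomy i k with h | h | h
    · by_contra hneg
      push Not at hneg
      obtain ⟨z, hz1, hz2⟩ := root_above (Q i) (by rw [hQd i h.le]; omega) (hQl i h.le) x hneg
      have := hζ.2 ⟨i, h, hz2⟩
      linarith
    · subst h; exact (hQk x).le
    · simp [hQbig i h]
  have hLnn : ∀ x, ζ ≤ x → ∀ i ≤ n, 0 ≤ b k * LF n b ((X + C x) ^ i) := by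
    intro x hx i hi
    have h1 := hQnn (n - i) x hx
    rw [hQLF (n - i) (by omega), Nat.sub_sub_self hi] at h1
    exact nonneg_of_mul_nonneg_right h1 (hdpos _ (by omega))
  have hh : ∀ x, b k * LF n b ((X + C x) ^ n) = 0 ↔ (hPoly n b).eval x = 0 := by
    intro x
    have h1 := deriv_eval n b x 0 (by omega)
    simp only [Function.iterate_zero, id, Nat.descFactorial_zero, Nat.cast_one, one_mul,
      Nat.sub_zero] at h1
    rw [h1, mul_eq_zero]
    simp [hk]
  have hlow : ∀ p ∈ constrainedFamily n b, -ζ ≤ abscissa p := by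
    intro p hp
    by_contra hlt
    push Not at hlt
    have h1 := lower n b (b k) (-abscissa p) (hLnn _ (by linarith)) p hp (by simp)
    have h2 : (Q 0).eval (-abscissa p) = 0 := by rw [hQLF 0 (by omega), Nat.sub_zero, h1, mul_zero]
    have := hζ.2 ⟨0, by omega, h2⟩
    linarith
  have hup : ∀ ε > 0, ∃ p ∈ constrainedFamily n b, abscissa p ≤ -ζ + ε := by
    intro ε hε
    obtain ⟨i, hik, hi0, himax⟩ : ∃ i < k, (Q i).eval ζ = 0 ∧ (Q (i + 1)).eval ζ ≠ 0 := by
      by_contra hcon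
      push Not at hcon
      obtain ⟨i, hi, hi0⟩ := hζ.1
      have : ∀ d, i + d ≤ k → (Q (i + d)).eval ζ = 0 := by
        intro d
        induction d with
        | zero => intro _; simpa using hi0
        | succ d ihd => intro hd; exact hcon (i + d) (by omega) (ihd (by omega))
      have h2 := this (k - i) (by omega)
      rw [Nat.add_sub_cancel' hi.le] at h2
      exact (hQk ζ).ne' h2
    have hder : derivative (Q i) = Q (i + 1) := by
      simp only [Q, derivative_C_mul, Function.iterate_succ_apply']
    have hpos : 0 < deriv (fun x => (Q i).eval x) ζ := by
      rw [Polynomial.deriv, hder]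
      exact lt_of_le_of_ne (hQnn _ _ le_rfl) (Ne.symm himax)
    have hev := eventually_nhdsWithin_sign_eq_of_deriv_pos hpos hi0
    obtain ⟨δ, hδ, hball⟩ := Metric.eventually_nhds_iff.1 hev
    have hmin : 0 < min (δ / 2) ε := lt_min (by linarith) hε
    have hs := @hball (ζ - min (δ / 2) ε) (by
      rw [Real.dist_eq]
      have : ζ - min (δ / 2) ε - ζ = -min (δ / 2) ε := by ring
      rw [this, abs_neg, abs_of_pos hmin]
      linarith [min_le_left (δ / 2) ε])
    rw [sign_neg (show ζ - min (δ / 2) ε - ζ < 0 by linarith), sign_eq_neg_one_iff,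
      hQLF i (by omega)] at hs
    have h2 := hQk (ζ - min (δ / 2) ε)
    rw [hQLF k hkn] at h2
    obtain ⟨p, hp, hpa⟩ := upper n i k hn (by omega) hkn b (b k) (ζ - min (δ / 2) ε)
      (by
        by_contra hc
        push Not at hc
        exact absurd hs (not_lt.2 (mul_nonneg (hdpos i (by omega)).le hc)))
      (pos_of_mul_pos_right h2 (hdpos k hkn).le)
    exact ⟨p, hp, by linarith [min_le_right (δ / 2) ε]⟩
  have hinf : sInf (abscissa '' constrainedFamily n b) = -ζ := by
    apply le_antisymm
    · refine le_of_forall_pos_le_add fun ε hε => ?_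
      obtain ⟨p, hp, hpa⟩ := hup ε hε
      refine (csInf_le ⟨-ζ, ?_⟩ (Set.mem_image_of_mem _ hp)).trans hpa
      rintro _ ⟨q, hq, rfl⟩
      exact hlow q hq
    · obtain ⟨p, hp, -⟩ := hup 1 one_pos
      refine le_csInf (Set.Nonempty.image _ ⟨p, hp⟩) ?_
      rintro _ ⟨q, hq, rfl⟩
      exact hlow q hq
  have hthird : (hPoly n b).eval ζ = 0 → (X - C (-ζ)) ^ n ∈ constrainedFamily n b ∧
      abscissa ((X - C (-ζ)) ^ n) = -ζ := by
    intro h0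
    refine ⟨(mem_family n b _).2 ⟨(monic_X_sub_C _).pow n, by simp, ?_⟩, abscissa_pow n hn _⟩
    have := (hh ζ).2 h0
    have := (mul_eq_zero.1 this).resolve_left hk
    simpa using this
  rw [hset, hinf, neg_neg]
  refine ⟨⟨ζ, hζ, rfl⟩, ⟨?_, fun h0 => ⟨_, hthird h0⟩⟩, hthird⟩
  rintro ⟨p, hp, hpa⟩
  exact (hh ζ).1 (lower n b (b k) ζ (hLnn ζ le_rfl) p hp hpa.le)
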